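/- Let μ be a finite Borel measure on ℝ³ supported on the unit sphere S², and suppose μ is invariant under the pushforward by the linear map x ↦ G x for each of the six matrices G ∈ {D_x, D_y, D_z, S_xy, S_yz, S_zx}. Then for every unit vector p ∈ ℝ³, ∫_{S²} (p · x)² dμ(x) = μ(S²)/3. -/

import Mathlib

open Matrix MeasureTheory

/-- `D_x = diag(-1,1,1)` -/
def Dx : Matrix (Fin 3) (Fin 3) ℝ := !![-1, 0, 0; 0, 1, 0; 0, 0, 1]
/-- `D_y = diag(1,-1,1)` -/
def Dy : Matrix (Fin 3) (Fin 3) ℝ := !![1, 0, 0; 0, -1, 0; 0, 0, 1]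
/-- `D_z = diag(1,1,-1)` -/
def Dz : Matrix (Fin 3) (Fin 3) ℝ := !![1, 0, 0; 0, 1, 0; 0, 0, -1]
/-- `S_xy` exchanges coordinates 1 and 2 -/
def Sxy : Matrix (Fin 3) (Fin 3) ℝ := !![0, 1, 0; 1, 0, 0; 0, 0, 1]
/-- `S_yz` exchanges coordinates 2 and 3 -/
def Syz : Matrix (Fin 3) (Fin 3) ℝ := !![1, 0, 0; 0, 0, 1; 0, 1, 0]
/-- `S_zx` exchanges coordinates 3 and 1 -/
def Szx : Matrix (Fin 3) (Fin 3) ℝ := !![0, 0, 1; 0, 1, 0; 1, 0, 0]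

theorem integral_comp_mulVec_eq_of_map_eq {n : Type*} [Fintype n]
    {μ : Measure (EuclideanSpace ℝ n)} {G : Matrix n n ℝ}
    (hG : μ.map (fun x : EuclideanSpace ℝ n =>
      (WithLp.toLp 2 (G *ᵥ x) : EuclideanSpace ℝ n)) = μ)
    {f : EuclideanSpace ℝ n → ℝ} (hf : Continuous f) :
    ∫ x, f (WithLp.toLp 2 (G *ᵥ x)) ∂μ = ∫ x, f x ∂μ := by
  have hcont : Continuous (fun x : EuclideanSpace ℝ n =>
      (WithLp.toLp 2 (G *ᵥ x) : EuclideanSpace ℝ n)) := by fun_prop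
  conv_rhs => rw [← hG]
  exact (integral_map hcont.aemeasurable hf.aestronglyMeasurable).symm

theorem integrable_coord_mul_coord {n : Type*} [Fintype n]
    {μ : Measure (EuclideanSpace ℝ n)} [IsFiniteMeasure μ]
    (h : ∀ᵐ x ∂μ, x ∈ Metric.sphere (0 : EuclideanSpace ℝ n) 1) (i j : n) :
    Integrable (fun x => x i * x j) μ := by
  have hcont : Continuous (fun x : EuclideanSpace ℝ n => x i * x j) := by fun_prop
  refine Integrable.of_bound hcont.aestronglyMeasurable 1 ?_
  filter_upwards [h] with x hx
  have hx1 : ‖x‖ = 1 := by simpa using hx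
  rw [norm_mul]
  exact mul_le_one₀ (hx1 ▸ PiLp.norm_apply_le x i) (norm_nonneg _)
    (hx1 ▸ PiLp.norm_apply_le x j)

/-- If a finite Borel measure `μ` on `ℝ³` is supported on the unit sphere `S²` and is invariant
under pushforward by each of the six cubic-symmetry generators, then for every unit vector `p`,
`∫_{S²} (p ⬝ x)² dμ(x) = μ(S²)/3`. -/
theorem integral_inner_sq_of_cubic_invariant
    (μ : Measure (EuclideanSpace ℝ (Fin 3))) [IsFiniteMeasure μ]
    (hsupp : μ (Metric.sphere (0 : EuclideanSpace ℝ (Fin 3)) 1)ᶜ = 0)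
    (hinv : ∀ G ∈ ({Dx, Dy, Dz, Sxy, Syz, Szx} : Set (Matrix (Fin 3) (Fin 3) ℝ)),
      μ.map (fun x : EuclideanSpace ℝ (Fin 3) => (WithLp.toLp 2 (G *ᵥ x) : EuclideanSpace ℝ (Fin 3))) = μ)
    (p : EuclideanSpace ℝ (Fin 3)) (hp : ‖p‖ = 1) :
    ∫ x in Metric.sphere (0 : EuclideanSpace ℝ (Fin 3)) 1, (inner ℝ p x : ℝ) ^ 2 ∂μ
      = (μ (Metric.sphere (0 : EuclideanSpace ℝ (Fin 3)) 1)).toReal / 3 := by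
  have hae : ∀ᵐ x ∂μ, x ∈ Metric.sphere (0 : EuclideanSpace ℝ (Fin 3)) 1 := hsupp
  have hint := integrable_coord_mul_coord hae
  have hmass : (μ (Metric.sphere (0 : EuclideanSpace ℝ (Fin 3)) 1)).toReal = μ.real Set.univ := by
    rw [Measure.real, measure_eq_measure_of_null_sdiff (Set.subset_univ _)]
    rwa [← Set.compl_eq_univ_sdiff]
  rw [Measure.restrict_eq_self_of_ae_mem hae, hmass]
  have h01 : ∫ x, x 0 * x 1 ∂μ = 0 := by
    simpa [Dx, Matrix.mulVec, dotProduct, Fin.sum_univ_three, integral_neg, neg_eq_self] using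
      integral_comp_mulVec_eq_of_map_eq (hinv Dx (by simp))
        (f := fun x => x 0 * x 1) (by fun_prop)
  have h02 : ∫ x, x 0 * x 2 ∂μ = 0 := by
    simpa [Dx, Matrix.mulVec, dotProduct, Fin.sum_univ_three, integral_neg, neg_eq_self] using
      integral_comp_mulVec_eq_of_map_eq (hinv Dx (by simp))
        (f := fun x => x 0 * x 2) (by fun_prop)
  have h12 : ∫ x, x 1 * x 2 ∂μ = 0 := by
    simpa [Dy, Matrix.mulVec, dotProduct, Fin.sum_univ_three, integral_neg, neg_eq_self] using
      integral_comp_mulVec_eq_of_map_eq (hinv Dy (by simp))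
        (f := fun x => x 1 * x 2) (by fun_prop)
  have h1 : ∫ x, x 1 * x 1 ∂μ = ∫ x, x 0 * x 0 ∂μ := by
    simpa [Sxy, Matrix.mulVec, dotProduct, Fin.sum_univ_three] using
      integral_comp_mulVec_eq_of_map_eq (hinv Sxy (by simp))
        (f := fun x => x 0 * x 0) (by fun_prop)
  have h2 : ∫ x, x 2 * x 2 ∂μ = ∫ x, x 0 * x 0 ∂μ := by
    simpa [Szx, Matrix.mulVec, dotProduct, Fin.sum_univ_three] using
      integral_comp_mulVec_eq_of_map_eq (hinv Szx (by simp))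
        (f := fun x => x 0 * x 0) (by fun_prop)
  have hsum : ∫ x, x 0 * x 0 ∂μ + ∫ x, x 1 * x 1 ∂μ + ∫ x, x 2 * x 2 ∂μ = μ.real Set.univ := by
    rw [← integral_add (hint 0 0) (hint 1 1),
      ← integral_add (f := fun x => x 0 * x 0 + x 1 * x 1)
        ((hint 0 0).add (hint 1 1)) (hint 2 2)]
    have h : (fun x : EuclideanSpace ℝ (Fin 3) => x 0 * x 0 + x 1 * x 1 + x 2 * x 2)
        =ᵐ[μ] fun _ => (1 : ℝ) := by
      filter_upwards [hae] with x hx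
      have hx1 : ‖x‖ = 1 := by simpa using hx
      have hsq := EuclideanSpace.real_norm_sq_eq x
      rw [hx1, Fin.sum_univ_three] at hsq
      linarith
    rw [integral_congr_ae h]
    simp
  have hp2 : p 0 ^ 2 + p 1 ^ 2 + p 2 ^ 2 = 1 := by
    have hsq := EuclideanSpace.real_norm_sq_eq p
    rw [hp, Fin.sum_univ_three] at hsq
    linarith
  have hexpand : ∫ x, (inner ℝ p x : ℝ) ^ 2 ∂μ
      = ∑ i, ∑ j, p i * p j * ∫ x, x i * x j ∂μ := by
    have hij (i j : Fin 3) :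
        Integrable (fun x : EuclideanSpace ℝ (Fin 3) => p i * p j * (x i * x j)) μ :=
      (hint i j).const_mul _
    simp_rw [← integral_const_mul]
    rw [Finset.sum_congr rfl fun i _ => (integral_finsetSum _ fun j _ => hij i j).symm,
      ← integral_finsetSum _ fun i _ => integrable_finsetSum _ fun j _ => hij i j]
    congr 1 with x
    simp only [PiLp.inner_apply, RCLike.inner_apply, conj_trivial, sq, Finset.sum_mul_sum]
    exact Finset.sum_congr rfl fun i _ => Finset.sum_congr rfl fun j _ => by ring
  have h10 : ∫ x, x 1 * x 0 ∂μ = 0 := by simpa only [mul_comm] using h01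
  have h20 : ∫ x, x 2 * x 0 ∂μ = 0 := by simpa only [mul_comm] using h02
  have h21 : ∫ x, x 2 * x 1 ∂μ = 0 := by simpa only [mul_comm] using h12
  have h0 : ∫ x, x 0 * x 0 ∂μ = μ.real Set.univ / 3 := by linarith
  simp only [hexpand, Fin.sum_univ_three, h01, h02, h12, h10, h20, h21, h1, h2, h0]
  linear_combination (μ.real Set.univ / 3) * hp2
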